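/- Every negative rational loop g in GL(n,ℂ) satisfying the GL(n,ℝ)-reality condition conj(g(conj λ)) = g(λ) can be written as a finite product of simple elements of the four types p_{α,β,V,W}, q_{α,β,V,W}, r_{α,β,V,W} and m_{α,k,N} listed in the context. -/

import Mathlib

set_option synthInstance.maxHeartbeats 1000000
set_option maxHeartbeats 1000000

open scoped Matrix ComplexConjugate

/-- Inclusion of constants into the field of rational functions. -/
noncomputable def ratC (z : ℂ) : RatFunc ℂ := algebraMap ℂ (RatFunc ℂ) z

/-- The conjugation `g(λ) ↦ conj (g (conj λ))` on rational functions: it conjugates the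
coefficients of numerator and denominator. -/
noncomputable def ratConj (f : RatFunc ℂ) : RatFunc ℂ :=
  algebraMap (Polynomial ℂ) (RatFunc ℂ) (f.num.map (starRingEnd ℂ)) /
  algebraMap (Polynomial ℂ) (RatFunc ℂ) (f.denom.map (starRingEnd ℂ))

/-- Simple element `p_{α,β,V,W}(λ) = ((λ-α)/(λ-β)) π_V + π_W` with `α,β ∈ ℝ` distinct,
`ℂⁿ = V ⊕ W`, `V̄ = V`, `W̄ = W`.  Decompositions `ℂⁿ = V ⊕ W` with conjugation-stable
summands, together with their projections, correspond exactly to idempotent matrices `P`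
fixed by entrywise conjugation (`V = im P`, `W = ker P`, `π_V = P`, `π_W = 1 - P`). -/
def IsSimplePReal {n : ℕ} (M : Matrix (Fin n) (Fin n) (RatFunc ℂ)) : Prop :=
  ∃ (α β : ℝ) (P : Matrix (Fin n) (Fin n) ℂ), α ≠ β ∧ P * P = P ∧
    P.map (starRingEnd ℂ) = P ∧
    M = ((RatFunc.X - RatFunc.C (α : ℂ)) / (RatFunc.X - RatFunc.C (β : ℂ))) • P.map ratC +
        (1 - P).map ratC

/-- Simple element `q_{α,β,V,W}(λ) = ((λ-α)(λ-ᾱ))/((λ-β)(λ-β̄)) π_V + π_W` with `α ≠ β`,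
at least one of `α, β` nonreal, `ℂⁿ = V ⊕ W`, `V̄ = V`, `W̄ = W`. -/
def IsSimpleQReal {n : ℕ} (M : Matrix (Fin n) (Fin n) (RatFunc ℂ)) : Prop :=
  ∃ (α β : ℂ) (P : Matrix (Fin n) (Fin n) ℂ), α ≠ β ∧ ¬(α.im = 0 ∧ β.im = 0) ∧
    P * P = P ∧ P.map (starRingEnd ℂ) = P ∧
    M = (((RatFunc.X - RatFunc.C α) * (RatFunc.X - RatFunc.C (conj α))) /
          ((RatFunc.X - RatFunc.C β) * (RatFunc.X - RatFunc.C (conj β)))) • P.map ratC +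
        (1 - P).map ratC

/-- Simple element `r_{α,β,V,W}(λ) = ((λ-α)/(λ-β)) π_V + π_W + ((λ-ᾱ)/(λ-β̄)) π_{V̄}`
with `α ≠ β` and a direct sum decomposition `ℂⁿ = V ⊕ W ⊕ V̄` (so `V ∩ V̄ = 0`), `W̄ = W`.
Such decompositions with their projections correspond exactly to systems of mutually
annihilating projections `P₁, P₂, P₃` summing to the identity with `P₃ = P̄₁`
(then automatically `P̄₂ = P₂`, i.e. `W̄ = W`). -/
def IsSimpleRReal {n : ℕ} (M : Matrix (Fin n) (Fin n) (RatFunc ℂ)) : Prop :=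
  ∃ (α β : ℂ) (P₁ P₂ : Matrix (Fin n) (Fin n) ℂ), α ≠ β ∧
    P₁ + P₂ + P₁.map (starRingEnd ℂ) = 1 ∧
    P₁ * P₂ = 0 ∧ P₂ * P₁ = 0 ∧
    P₁ * P₁.map (starRingEnd ℂ) = 0 ∧ P₁.map (starRingEnd ℂ) * P₁ = 0 ∧
    P₂ * P₁.map (starRingEnd ℂ) = 0 ∧ P₁.map (starRingEnd ℂ) * P₂ = 0 ∧
    M = ((RatFunc.X - RatFunc.C α) / (RatFunc.X - RatFunc.C β)) • P₁.map ratC +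
        P₂.map ratC +
        ((RatFunc.X - RatFunc.C (conj α)) / (RatFunc.X - RatFunc.C (conj β))) •
          (P₁.map (starRingEnd ℂ)).map ratC

/-- Simple element `m_{α,k,N}(λ) = Id + (λ-α)^{-k} N` with `α ∈ ℝ`, `k ≥ 1`, `N` a real
matrix with `N² = 0`. -/
def IsSimpleMReal {n : ℕ} (M : Matrix (Fin n) (Fin n) (RatFunc ℂ)) : Prop :=
  ∃ (α : ℝ) (k : ℕ) (N : Matrix (Fin n) (Fin n) ℂ), 1 ≤ k ∧ N * N = 0 ∧
    N.map (starRingEnd ℂ) = N ∧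
    M = 1 + ((RatFunc.X - RatFunc.C (α : ℂ)) ^ k)⁻¹ • N.map ratC

/-- The conjugation `ratConj` as a ring homomorphism. -/
noncomputable def ratConjHom : RatFunc ℂ →+* RatFunc ℂ :=
  RatFunc.mapRingHom (Polynomial.mapRingHom (starRingEnd ℂ))
    (nonZeroDivisors_le_comap_nonZeroDivisors_of_injective _
      (Polynomial.map_injective _ (starRingEnd ℂ).injective))

theorem ratConjHom_apply (f : RatFunc ℂ) : ratConjHom f = ratConj f := by
  unfold ratConjHom ratConj
  rw [RatFunc.coe_mapRingHom_eq_coe_map, RatFunc.map_apply]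
  rfl

open Classical in
/-- Rational functions that are real and vanish at infinity. -/
def IsRealProper (f : RatFunc ℂ) : Prop :=
  ratConjHom f = f ∧ RatFunc.inftyValuation ℂ f < 1

namespace IsRealProper

variable {f g : RatFunc ℂ}

theorem zero : IsRealProper 0 := ⟨map_zero _, by simp⟩

theorem add (hf : IsRealProper f) (hg : IsRealProper g) : IsRealProper (f + g) :=
  ⟨by rw [map_add, hf.1, hg.1], Valuation.map_add_lt _ hf.2 hg.2⟩

theorem neg (hf : IsRealProper f) : IsRealProper (-f) :=
  ⟨by rw [map_neg, hf.1], by rw [Valuation.map_neg]; exact hf.2⟩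

theorem sub (hf : IsRealProper f) (hg : IsRealProper g) : IsRealProper (f - g) := by
  rw [sub_eq_add_neg]; exact hf.add hg.neg

theorem mul (hf : IsRealProper f) (hg : IsRealProper g) : IsRealProper (f * g) :=
  ⟨by rw [map_mul, hf.1, hg.1], by rw [map_mul]; exact mul_lt_one' hf.2 hg.2⟩

theorem one_add_ne_zero (hf : IsRealProper f) : 1 + f ≠ 0 := by
  intro h
  have := Valuation.map_one_add_of_lt _ hf.2
  rw [h, map_zero] at this
  exact zero_ne_one this

theorem div_one_add (hf : IsRealProper f) (hg : IsRealProper g) :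
    IsRealProper (f / (1 + g)) :=
  ⟨by rw [map_div₀, map_add, map_one, hf.1, hg.1],
    by rw [map_div₀, Valuation.map_one_add_of_lt _ hg.2, div_one]; exact hf.2⟩

theorem of_intDegree (hr : ratConj f = f) (hd : f = 0 ∨ f.intDegree < 0) : IsRealProper f := by
  classical
  refine ⟨by rw [ratConjHom_apply, hr], ?_⟩
  rcases hd with rfl | hd
  · simp
  · by_cases h0 : f = 0
    · simp [h0]
    · rw [RatFunc.inftyValuation_apply, RatFunc.inftyValuation_of_nonzero _ h0,
        ← WithZero.exp_zero, WithZero.exp_lt_exp]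
      exact hd

end IsRealProper

theorem num_denom_of_isRealProper_sub_one {f : RatFunc ℂ} (hf : IsRealProper (f - 1)) :
    f.num.map (starRingEnd ℂ) = f.num ∧ f.denom.map (starRingEnd ℂ) = f.denom ∧
      f.num.Monic ∧ f.num.natDegree = f.denom.natDegree := by
  have hd0 : algebraMap (Polynomial ℂ) (RatFunc ℂ) f.denom ≠ 0 :=
    RatFunc.algebraMap_ne_zero f.denom_ne_zero
  have hfix : ratConj f = f := by
    rw [← ratConjHom_apply]
    have := hf.1
    rwa [map_sub, map_one, sub_left_inj] at this
  have hm : (f.denom.map (starRingEnd ℂ)).Monic := f.monic_denom.map _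
  have hden : f.denom.map (starRingEnd ℂ) = f.denom := by
    refine (Polynomial.eq_of_monic_of_dvd_of_natDegree_le f.monic_denom hm
      ((RatFunc.denom_dvd hm.ne_zero).2 ⟨_, hfix.symm⟩) ?_)
    rw [Polynomial.natDegree_map]
  have hnum : f.num.map (starRingEnd ℂ) = f.num := by
    have h2 := hfix
    conv_rhs at h2 => rw [← RatFunc.num_div_denom f]
    unfold ratConj at h2
    rw [hden, div_left_inj' hd0] at h2
    exact RatFunc.algebraMap_injective ℂ h2
  have hdeg : (f.num - f.denom).degree < f.denom.degree := by
    classical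
    by_cases h0 : f.num - f.denom = 0
    · rw [h0, Polynomial.degree_zero, bot_lt_iff_ne_bot]
      exact mt Polynomial.degree_eq_bot.1 f.denom_ne_zero
    have e : f - 1 = algebraMap (Polynomial ℂ) (RatFunc ℂ) (f.num - f.denom) /
        algebraMap (Polynomial ℂ) (RatFunc ℂ) f.denom := by
      rw [map_sub, sub_div, RatFunc.num_div_denom, div_self hd0]
    have hv := hf.2
    rw [e, map_div₀, RatFunc.inftyValuation_apply, RatFunc.inftyValuation_apply,
      RatFunc.inftyValuation.polynomial _ h0, RatFunc.inftyValuation.polynomial _ f.denom_ne_zero,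
      div_lt_one₀ (by simp), WithZero.exp_lt_exp] at hv
    exact Polynomial.degree_lt_degree (by exact_mod_cast hv)
  refine ⟨hnum, hden, ?_, ?_⟩
  · have := f.monic_denom.add_of_left hdeg
    rwa [add_sub_cancel] at this
  · have := Polynomial.natDegree_add_eq_left_of_degree_lt hdeg
    rwa [add_sub_cancel] at this

theorem ratC_eq : ratC = (RatFunc.C : ℂ →+* RatFunc ℂ) := by
  funext z; rfl

section Dilation

variable {n : ℕ}

/-- The loop acting by `f` on the image of `P` and trivially on its kernel. -/
noncomputable def dilation (P : Matrix (Fin n) (Fin n) ℂ) (f : RatFunc ℂ) :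
    Matrix (Fin n) (Fin n) (RatFunc ℂ) :=
  f • P.map ratC + (1 - P).map ratC

theorem dilation_eq (P : Matrix (Fin n) (Fin n) ℂ) (f : RatFunc ℂ) :
    dilation P f = 1 + (f - 1) • P.map ratC := by
  unfold dilation
  rw [ratC_eq, Matrix.map_sub _ (map_sub _), Matrix.map_one _ (map_zero _) (map_one _), sub_smul,
    one_smul]
  abel

theorem dilation_one (P : Matrix (Fin n) (Fin n) ℂ) : dilation P 1 = 1 := by
  simp [dilation_eq]

theorem dilation_mul {P : Matrix (Fin n) (Fin n) ℂ} (hP : P * P = P) (f g : RatFunc ℂ) :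
    dilation P f * dilation P g = dilation P (f * g) := by
  have h : P.map ratC * P.map ratC = P.map ratC := by
    rw [ratC_eq, ← Matrix.map_mul, hP]
  simp only [dilation_eq, mul_add, add_mul, one_mul, mul_one, smul_mul_assoc, mul_smul_comm, h,
    smul_add, smul_smul]
  have e : f * g - 1 = (f - 1) + (g - 1) + (f - 1) * (g - 1) := by ring
  rw [e, add_smul, add_smul, mul_comm (g - 1)]
  abel

/-- The monoid generated by the simple elements. -/
noncomputable def simpleMonoid (n : ℕ) : Submonoid (Matrix (Fin n) (Fin n) (RatFunc ℂ)) :=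
  Submonoid.closure {M | IsSimplePReal M ∨ IsSimpleQReal M ∨ IsSimpleRReal M ∨ IsSimpleMReal M}

theorem dilation_linear_mem {P : Matrix (Fin n) (Fin n) ℂ} (hP : P * P = P)
    (hPr : P.map (starRingEnd ℂ) = P) (α β : ℝ) :
    dilation P ((RatFunc.X - RatFunc.C (α : ℂ)) / (RatFunc.X - RatFunc.C (β : ℂ))) ∈
      simpleMonoid n := by
  by_cases h : α = β
  · have h0 : (RatFunc.X - RatFunc.C (β : ℂ)) ≠ 0 := by
      have := RatFunc.algebraMap_ne_zero (Polynomial.X_sub_C_ne_zero (β : ℂ))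
      simpa using this
    rw [h, div_self h0, dilation_one]
    exact one_mem _
  · exact Submonoid.subset_closure (Or.inl ⟨α, β, P, h, hP, hPr, rfl⟩)

theorem dilation_quadratic_mem {P : Matrix (Fin n) (Fin n) ℂ} (hP : P * P = P)
    (hPr : P.map (starRingEnd ℂ) = P) {α β : ℂ} (h : α ≠ β) (him : ¬(α.im = 0 ∧ β.im = 0)) :
    dilation P (((RatFunc.X - RatFunc.C α) * (RatFunc.X - RatFunc.C (conj α))) /
          ((RatFunc.X - RatFunc.C β) * (RatFunc.X - RatFunc.C (conj β)))) ∈ simpleMonoid n :=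
  Submonoid.subset_closure (Or.inr (Or.inl ⟨α, β, P, h, him, hP, hPr, rfl⟩))

theorem Polynomial.map_conj_of_mul_left {p q : Polynomial ℂ} (hp : p ≠ 0)
    (hpc : p.map (starRingEnd ℂ) = p) (h : (p * q).map (starRingEnd ℂ) = p * q) :
    q.map (starRingEnd ℂ) = q := by
  rw [Polynomial.map_mul, hpc] at h
  exact mul_left_cancel₀ hp h

theorem dilation_div_X_pow_mem {P : Matrix (Fin n) (Fin n) ℂ} (hP : P * P = P)
    (hPr : P.map (starRingEnd ℂ) = P) (d : ℕ) :
    ∀ a : Polynomial ℂ, a.Monic → a.natDegree = d → a.map (starRingEnd ℂ) = a →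
      dilation P (algebraMap _ (RatFunc ℂ) a / RatFunc.X ^ d) ∈ simpleMonoid n ∧
      dilation P (RatFunc.X ^ d / algebraMap _ (RatFunc ℂ) a) ∈ simpleMonoid n := by
  induction d using Nat.strong_induction_on with
  | _ d ih =>
  intro a ha had hac
  rcases Nat.eq_zero_or_pos d with rfl | hd
  · rw [ha.natDegree_eq_zero.1 had]
    simp [dilation_one, one_mem]
  obtain ⟨z, hz⟩ := IsAlgClosed.exists_root a
    (by rw [Polynomial.degree_eq_natDegree ha.ne_zero, had]; exact_mod_cast hd.ne')
  obtain ⟨b, rfl⟩ := Polynomial.dvd_iff_isRoot.2 hz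
  have hXz := Polynomial.monic_X_sub_C z
  have hb : b.Monic := hXz.of_mul_monic_left ha
  have hbd : b.natDegree + 1 = d := by
    rw [hXz.natDegree_mul hb, Polynomial.natDegree_X_sub_C] at had
    omega
  by_cases hzr : conj z = z
  · obtain ⟨r, rfl⟩ := Complex.conj_eq_iff_real.1 hzr
    have hbc := Polynomial.map_conj_of_mul_left hXz.ne_zero (by simp) hac
    obtain ⟨h1, h2⟩ := ih b.natDegree (by omega) b hb rfl hbc
    have k1 := dilation_linear_mem hP hPr r 0
    have k2 := dilation_linear_mem hP hPr 0 r
    have e1 := mul_mem k1 h1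
    have e2 := mul_mem k2 h2
    rw [dilation_mul hP, div_mul_div_comm] at e1 e2
    subst hbd
    simp only [Complex.ofReal_zero, map_zero, sub_zero, ← pow_succ'] at e1 e2
    simpa using And.intro e1 e2
  · have hroot : b.IsRoot (conj z) := by
      have h1 : ((Polynomial.X - Polynomial.C z) * b).eval (conj z) = 0 := by
        rw [← hac, Polynomial.eval_map, Polynomial.eval₂_hom, hz.eq_zero, map_zero]
      rw [Polynomial.eval_mul, mul_eq_zero] at h1
      refine h1.resolve_left ?_
      simpa [sub_eq_zero] using hzr
    obtain ⟨c, rfl⟩ := Polynomial.dvd_iff_isRoot.2 hroot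
    have hXz' := Polynomial.monic_X_sub_C (conj z)
    have hc : c.Monic := hXz'.of_mul_monic_left hb
    have hcd : c.natDegree + 2 = d := by
      rw [hXz'.natDegree_mul hc, Polynomial.natDegree_X_sub_C] at hbd
      omega
    rw [← mul_assoc] at hac ⊢
    have hcc := Polynomial.map_conj_of_mul_left (mul_ne_zero hXz.ne_zero hXz'.ne_zero)
      (by simp [mul_comm]) hac
    obtain ⟨h1, h2⟩ := ih c.natDegree (by omega) c hc rfl hcc
    have hz0 : z ≠ 0 := by rintro rfl; simp at hzr
    have him : z.im ≠ 0 := fun h => hzr (Complex.conj_eq_iff_im.2 h)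
    have k1 := dilation_quadratic_mem hP hPr hz0 (fun h => him h.1)
    have k2 := dilation_quadratic_mem hP hPr hz0.symm (fun h => him h.2)
    have e1 := mul_mem k1 h1
    have e2 := mul_mem k2 h2
    rw [dilation_mul hP, div_mul_div_comm] at e1 e2
    subst hcd
    simp only [map_zero, sub_zero, ← pow_two, ← pow_add, add_comm 2] at e1 e2
    simpa using And.intro e1 e2

theorem dilation_mem {P : Matrix (Fin n) (Fin n) ℂ} (hP : P * P = P)
    (hPr : P.map (starRingEnd ℂ) = P) {f : RatFunc ℂ} (hf : IsRealProper (f - 1)) :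
    dilation P f ∈ simpleMonoid n := by
  obtain ⟨hn, hd, hm, hdeg⟩ := num_denom_of_isRealProper_sub_one hf
  have h := mul_mem (dilation_div_X_pow_mem hP hPr _ _ hm hdeg hn).1
    (dilation_div_X_pow_mem hP hPr _ _ f.monic_denom rfl hd).2
  rwa [dilation_mul hP, div_mul_div_cancel₀ (pow_ne_zero _ RatFunc.X_ne_zero),
    RatFunc.num_div_denom] at h

open Matrix in
theorem one_add_single_mem (k : Fin n) {f : RatFunc ℂ} (hf : IsRealProper f) :
    1 + single k k f ∈ simpleMonoid n := by
  have h : dilation (single k k 1) (1 + f) ∈ simpleMonoid n :=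
    dilation_mem (by simp) (by simp [map_single]) (by simpa using hf)
  simpa [dilation_eq, ratC_eq, map_single, smul_single] using h

open Matrix in
theorem transvection_mem {i k : Fin n} (hik : i ≠ k) {f : RatFunc ℂ} (hf : IsRealProper f) :
    1 + single i k f ∈ simpleMonoid n := by
  have hne : 1 + -f ≠ 0 := hf.neg.one_add_ne_zero
  have hinv : (1 + -f)⁻¹ - 1 = f / (1 + -f) := by field_simp; ring
  have h1 : dilation (single k k 1 + single i k 1) (1 + -f)⁻¹ ∈ simpleMonoid n :=
    dilation_mem (by simp [mul_add, add_mul, hik.symm])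
      (by simp [Matrix.map_add, map_single]) (by rw [hinv]; exact hf.div_one_add hf.neg)
  have h := mul_mem h1 (one_add_single_mem k hf.neg)
  convert h using 1
  simp only [dilation_eq, ratC_eq, Matrix.map_add _ (map_add _), map_single, map_one, smul_add,
    smul_single, hinv, mul_add, add_mul, one_mul, mul_one, single_mul_single_same, smul_eq_mul]
  have e : f / (1 + -f) * -f = f - f / (1 + -f) := by field_simp; ring
  rw [e]
  ext a b
  simp only [Matrix.add_apply, single_apply]
  split_ifs <;> ring

open Matrix in
theorem one_add_sum_single_mem (k : Fin n) (u : Fin n → RatFunc ℂ) (s : Finset (Fin n))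
    (hu : ∀ i ∈ s, IsRealProper (u i)) (hk : k ∉ s) :
    1 + ∑ i ∈ s, single i k (u i) ∈ simpleMonoid n := by
  induction s using Finset.induction_on with
  | empty => simp [one_mem]
  | insert i s hi ih =>
    have hik : i ≠ k := fun h => hk (h ▸ Finset.mem_insert_self _ _)
    have h := mul_mem
      (ih (fun j hj => hu j (Finset.mem_insert_of_mem hj))
        fun h => hk (Finset.mem_insert_of_mem h))
      (transvection_mem hik (hu i (Finset.mem_insert_self _ _)))
    rw [Finset.sum_insert hi]
    convert h using 1
    simp [mul_add, add_mul, Finset.sum_mul, hik.symm]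
    abel

open Matrix in
theorem mem_simpleMonoid_of_column_support (s : Finset (Fin n)) :
    ∀ g : Matrix (Fin n) (Fin n) (RatFunc ℂ), (∀ i j, IsRealProper ((g - 1) i j)) →
      (∀ i, ∀ j ∉ s, (g - 1) i j = 0) → g ∈ simpleMonoid n := by
  induction s using Finset.induction_on with
  | empty =>
    intro g _ hg
    have : g - 1 = 0 := by ext i j; exact hg i j (Finset.notMem_empty j)
    rw [sub_eq_zero.1 this]
    exact one_mem _
  | insert k s hk ih =>
    intro g hg hs
    obtain ⟨a, rfl⟩ : ∃ a, g = 1 + a := ⟨g - 1, by abel⟩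
    simp only [add_sub_cancel_left] at hg hs
    have hne : 1 + a k k ≠ 0 := (hg k k).one_add_ne_zero
    -- the matrix obtained by clearing the `k`-th column
    set b : Matrix (Fin n) (Fin n) (RatFunc ℂ) := fun i j =>
      if j = k then 0 else if i = k then a k j / (1 + a k k)
        else a i j - a i k * (a k j / (1 + a k k)) with hb
    have hbm : 1 + b ∈ simpleMonoid n := by
      apply ih
      · intro i j
        rw [add_sub_cancel_left]
        simp only [hb]
        split_ifs
        · exact .zero
        · exact (hg k j).div_one_add (hg k k)
        · exact (hg i j).sub ((hg i k).mul ((hg k j).div_one_add (hg k k)))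
      · intro i j hj
        rw [add_sub_cancel_left]
        simp only [hb]
        split_ifs with h1 h2
        · rfl
        · rw [hs k j (by simp [h1, hj]), zero_div]
        · rw [hs k j (by simp [h1, hj]), hs i j (by simp [h1, hj])]; simp
    have h := mul_mem (mul_mem (one_add_single_mem k (hg k k))
      (one_add_sum_single_mem k (fun i => a i k) (Finset.univ.erase k)
        (fun i _ => hg i k) (Finset.notMem_erase _ _))) hbm
    have hcol : (1 + single k k (a k k)) * (1 + ∑ i ∈ Finset.univ.erase k, single i k (a i k)) =
        1 + ∑ i, single i k (a i k) := by
      rw [← Finset.add_sum_erase _ _ (Finset.mem_univ k), mul_add, mul_one, add_mul, one_mul,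
        Finset.mul_sum, Finset.sum_eq_zero (s := Finset.univ.erase k)
          (f := fun i => single k k (a k k) * single i k (a i k)), add_zero, add_assoc]
      intro i hi
      simp [(Finset.ne_of_mem_erase hi).symm]
    rw [hcol] at h
    convert h using 1
    rw [add_mul, one_mul, mul_add, mul_one, add_assoc, add_right_inj]
    ext i j
    have e1 : (∑ l, single l k (a l k)) i j = if j = k then a i k else 0 := by
      rw [Matrix.sum_apply, Finset.sum_eq_single i]
      · simp [single_apply, eq_comm]
      · intro l _ hl; simp [hl]
      · simp
    have e2 : ((∑ l, single l k (a l k)) * b) i j = a i k * b k j := by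
      rw [Finset.sum_mul, Matrix.sum_apply, Finset.sum_eq_single i]
      · simp
      · intro l _ hl; simp [hl.symm]
      · simp
    simp only [Matrix.add_apply, e1, e2]
    by_cases hj : j = k
    · subst hj; simp [hb]
    · by_cases hi : i = k
      · subst hi
        simp only [hb, hj, if_false, if_true]
        field_simp
        ring
      · simp only [hb, hj, hi, if_false, if_true]
        ring

end Dilation

/-- **Generating theorem for the `GL(n,ℝ)`-reality condition.**
Every negative rational loop `g` in `GL(n,ℂ)` satisfying the reality condition
`conj (g (conj λ)) = g(λ)` (entrywise, `ratConj` fixes every entry of `g`) is a finite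
product of simple elements of the four types `p`, `q`, `r` and `m`. -/
theorem generating_GLnR_reality (n : ℕ) (g : Matrix (Fin n) (Fin n) (RatFunc ℂ))
    (hdet : g.det ≠ 0)
    (hneg : ∀ i j, (g - 1) i j = 0 ∨ ((g - 1) i j).intDegree < 0)
    (hreal : ∀ i j, ratConj (g i j) = g i j) :
    ∃ L : List (Matrix (Fin n) (Fin n) (RatFunc ℂ)),
      (∀ M ∈ L, IsSimplePReal M ∨ IsSimpleQReal M ∨ IsSimpleRReal M ∨ IsSimpleMReal M) ∧
      g = L.prod := by
  have hg : ∀ i j, IsRealProper ((g - 1) i j) := by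
    refine fun i j => .of_intDegree ?_ (hneg i j)
    rw [← ratConjHom_apply, Matrix.sub_apply, map_sub, ratConjHom_apply, hreal,
      Matrix.one_apply]
    split_ifs <;> simp
  obtain ⟨L, hL, hprod⟩ := Submonoid.exists_list_of_mem_closure
    (mem_simpleMonoid_of_column_support Finset.univ g hg fun i j hj =>
      absurd (Finset.mem_univ j) hj)
  exact ⟨L, hL, hprod.symm⟩
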